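/- Let q = p₀^e be a prime power with q ∈ {7, 8} or q ≥ 11, where p₀ is prime, and let d = gcd(2, q−1). Then PSL₂(F_q) has a generating triple of type ((q+1)/d, (q−1)/d, (q−1)/d), i.e. there exist x, y, z ∈ PSL₂(F_q) with x·y·z = 1, {x,y,z} generating PSL₂(F_q), ord x = (q+1)/d and ord y = ord z = (q−1)/d. -/

import Mathlib

open scoped MatrixGroups

/-- `Σ(T)`: the union of all conjugates of the cyclic subgroups generated by the
three entries of the triple `T = (a, b, c)`. -/
def SigmaSet {G : Type*} [Group G] (T : G × G × G) : Set G :=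
  {x | ∃ g : G, g * x * g⁻¹ ∈
    (Subgroup.zpowers T.1 : Set G) ∪ (Subgroup.zpowers T.2.1 : Set G) ∪
      (Subgroup.zpowers T.2.2 : Set G)}

/-- `T = (a,b,c)` is a generating triple: `a*b*c = 1` and `{a,b,c}` generates. -/
def IsGenTriple {G : Type*} [Group G] (T : G × G × G) : Prop :=
  T.1 * T.2.1 * T.2.2 = 1 ∧ Subgroup.closure {T.1, T.2.1, T.2.2} = ⊤

/-- `T` is hyperbolic: the reciprocals of the orders of its entries sum to less than 1. -/
def IsHyperbolic {G : Type*} [Group G] (T : G × G × G) : Prop :=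
  (orderOf T.1 : ℚ)⁻¹ + (orderOf T.2.1 : ℚ)⁻¹ + (orderOf T.2.2 : ℚ)⁻¹ < 1

/-- An unmixed Beauville structure on `G`: a pair of hyperbolic generating triples
`T₁, T₂` with `Σ(T₁) ∩ Σ(T₂) = {1}`. -/
def HasBeauvilleStructure (G : Type*) [Group G] : Prop :=
  ∃ T₁ T₂ : G × G × G, IsGenTriple T₁ ∧ IsHyperbolic T₁ ∧ IsGenTriple T₂ ∧ IsHyperbolic T₂ ∧
    SigmaSet T₁ ∩ SigmaSet T₂ = {1}

/-- `φ₂(H)`: the number of ordered generating pairs of `H`. -/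
noncomputable def phi2 (H : Type*) [Group H] : ℕ :=
  Nat.card {p : H × H // Subgroup.closure {p.1, p.2} = ⊤}

/-- Two triples are equivalent if some automorphism carries one to the other entrywise. -/
def TripleEquiv {H : Type*} [Group H] (T T' : H × H × H) : Prop :=
  ∃ α : MulAut H, α T.1 = T'.1 ∧ α T.2.1 = T'.2.1 ∧ α T.2.2 = T'.2.2

/-- `H` contains the matrix with rows `(p, r)` and `(s, t)`. -/
def SL2Mem {F : Type*} [Field F] (H : Subgroup SL(2, F)) (p r s t : F) : Prop :=
  ∃ M ∈ H, M 0 0 = p ∧ M 0 1 = r ∧ M 1 0 = s ∧ M 1 1 = t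

namespace SL2Mem

variable {F : Type*} [Field F] {H : Subgroup SL(2, F)} {p r s t p' r' s' t' : F}

theorem of_mem {M : SL(2, F)} (hM : M ∈ H) : SL2Mem H (M 0 0) (M 0 1) (M 1 0) (M 1 1) :=
  ⟨M, hM, rfl, rfl, rfl, rfl⟩

theorem mem {M : SL(2, F)} (h : SL2Mem H (M 0 0) (M 0 1) (M 1 0) (M 1 1)) : M ∈ H := by
  obtain ⟨N, hN, h₁, h₂, h₃, h₄⟩ := h
  have : M = N := by
    ext i j
    fin_cases i <;> fin_cases j <;> simp_all
  exact this ▸ hN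

theorem det (h : SL2Mem H p r s t) : p * t - r * s = 1 := by
  obtain ⟨M, -, rfl, rfl, rfl, rfl⟩ := h
  rw [← Matrix.det_fin_two, M.det_coe]

theorem mul (h : SL2Mem H p r s t) (h' : SL2Mem H p' r' s' t') :
    SL2Mem H (p * p' + r * s') (p * r' + r * t') (s * p' + t * s') (s * r' + t * t') := by
  obtain ⟨M, hM, rfl, rfl, rfl, rfl⟩ := h
  obtain ⟨N, hN, rfl, rfl, rfl, rfl⟩ := h'
  refine ⟨M * N, mul_mem hM hN, ?_⟩
  simp [Matrix.mul_apply, Fin.sum_univ_two]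

theorem inv (h : SL2Mem H p r s t) : SL2Mem H t (-r) (-s) p := by
  obtain ⟨M, hM, rfl, rfl, rfl, rfl⟩ := h
  refine ⟨M⁻¹, inv_mem hM, ?_⟩
  simp [Matrix.SpecialLinearGroup.coe_inv, Matrix.adjugate_fin_two]

theorem congr (h : SL2Mem H p r s t) (hp : p = p') (hr : r = r') (hs : s = s') (ht : t = t') :
    SL2Mem H p' r' s' t' := by
  subst hp hr hs ht
  exact h

end SL2Mem

/-- In a finite field every element is a sum of two squares. -/
theorem FiniteField.exists_sq_add_sq {F : Type*} [Field F] [Finite F] (c : F) :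
    ∃ a b : F, a ^ 2 + b ^ 2 = c := by
  have := Fintype.ofFinite F
  by_cases h2 : ringChar F = 2
  · obtain ⟨a, ha⟩ := FiniteField.isSquare_of_char_two h2 c
    exact ⟨a, 0, by rw [ha]; ring⟩
  · open Polynomial in
    obtain ⟨a, b, hab⟩ := FiniteField.exists_root_sum_quadratic (R := F) (f := X ^ 2)
      (g := X ^ 2 - C c) (by simp) (by compute_degree!)
      (FiniteField.odd_card_of_char_ne_two h2)
    refine ⟨a, b, ?_⟩
    simp at hab
    linear_combination hab

/-- Among three nonzero elements of a finite field, two lie in the same square class. -/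
theorem FiniteField.exists_eq_sq_mul {F : Type*} [Field F] [Finite F] {a b c : F}
    (ha : a ≠ 0) (hb : b ≠ 0) (hc : c ≠ 0) :
    (∃ l : F, l ≠ 0 ∧ a = l ^ 2 * b) ∨ (∃ l : F, l ≠ 0 ∧ a = l ^ 2 * c) ∨
      ∃ l : F, l ≠ 0 ∧ b = l ^ 2 * c := by
  classical
  have := Fintype.ofFinite F
  have key : ∀ {u v : F}, u ≠ 0 → v ≠ 0 → quadraticChar F u = quadraticChar F v →
      ∃ l : F, l ≠ 0 ∧ u = l ^ 2 * v := by
    intro u v hu hv huv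
    have h1 : quadraticChar F (u * v) = 1 := by
      rw [map_mul, huv, ← sq, quadraticChar_sq_one hv]
    obtain ⟨l, hl⟩ := (quadraticChar_one_iff_isSquare (mul_ne_zero hu hv)).1 h1
    have hl0 : l ≠ 0 := by
      rintro rfl
      simp [hu, hv] at hl
    refine ⟨l / v, div_ne_zero hl0 hv, ?_⟩
    field_simp
    linear_combination hl
  rcases quadraticChar_dichotomy ha with h | h <;> rcases quadraticChar_dichotomy hb with h' | h'
    <;> rcases quadraticChar_dichotomy hc with h'' | h''
  all_goals first
    | exact Or.inl (key ha hb (h.trans h'.symm))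
    | exact Or.inr (Or.inl (key ha hc (h.trans h''.symm)))
    | exact Or.inr (Or.inr (key hb hc (h'.trans h''.symm)))

namespace SL2Mem

variable {F : Type*} [Field F] {H : Subgroup SL(2, F)} {p r s t p' r' s' t' : F}

/-- A subgroup of `SL(2, F)` that contains the diagonal torus, a nontrivial upper unipotent
matrix and a matrix that is not upper triangular is everything. -/
theorem eq_top_of_upper [Finite F] (hD : ∀ g : F, g ≠ 0 → SL2Mem H g 0 0 g⁻¹) {b : F}
    (hb : b ≠ 0) (hB : SL2Mem H 1 b 0 1) (hx : SL2Mem H p r s t) (hs : s ≠ 0) : H = ⊤ := by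
  have hsq : ∀ g : F, SL2Mem H 1 (g ^ 2 * b) 0 1 := by
    intro g
    rcases eq_or_ne g 0 with rfl | hg
    · exact ((hD 1 one_ne_zero)).congr rfl (by ring) rfl inv_one
    · refine (((hD g hg).mul hB).mul (hD g hg).inv).congr ?_ ?_ ?_ ?_ <;> field_simp <;> ring
  have hU : ∀ c : F, SL2Mem H 1 c 0 1 := by
    intro c
    obtain ⟨u, v, huv⟩ := FiniteField.exists_sq_add_sq (c / b)
    refine ((hsq u).mul (hsq v)).congr (by ring) ?_ (by ring) (by ring)
    field_simp at huv
    linear_combination huv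
  have hdet := hx.det
  have hW : SL2Mem H 0 (-s⁻¹) s 0 := by
    refine (((hU (-p / s)).mul hx).mul (hU (-t / s))).congr ?_ ?_ ?_ ?_ <;> field_simp
    · ring
    · linear_combination -hdet
    · ring
    · ring
  have hL : ∀ c : F, SL2Mem H 1 0 c 1 := by
    intro c
    refine ((hW.mul (hU (-c / s ^ 2))).mul hW.inv).congr ?_ ?_ ?_ ?_ <;> field_simp <;> ring
  have hne : ∀ {p r s t : F}, p * t - r * s = 1 → s ≠ 0 → SL2Mem H p r s t := by
    intro p r s t hdet hs
    refine (((hU ((p - 1) / s)).mul (hL s)).mul (hU ((t - 1) / s))).congr ?_ ?_ ?_ ?_ <;>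
      field_simp
    · ring
    · linear_combination hdet
    · ring
    · ring
  rw [eq_top_iff]
  intro M _
  apply SL2Mem.mem
  have hM := M.det_coe
  rw [Matrix.det_fin_two] at hM
  by_cases h : M 1 0 = 0
  · have h0 : M 0 0 ≠ 0 := by
      intro h0
      simp [h, h0] at hM
    refine ((hL (-1)).mul (hne (p := M 0 0) (r := M 0 1) (s := M 0 0) (t := M 0 1 + M 1 1) ?_
      h0)).congr ?_ ?_ ?_ ?_
    · linear_combination hM + M 0 1 * h
    · ring
    · ring
    · linear_combination -h
    · ring
  · exact hne hM h

/-- A subgroup of `SL(2, F)` that contains the diagonal torus, a nontrivial lower unipotent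
matrix and a matrix that is not lower triangular is everything. -/
theorem eq_top_of_lower [Finite F] (hD : ∀ g : F, g ≠ 0 → SL2Mem H g 0 0 g⁻¹) {b : F}
    (hb : b ≠ 0) (hB : SL2Mem H 1 0 b 1) (hx : SL2Mem H p r s t) (hr : r ≠ 0) : H = ⊤ := by
  obtain ⟨w, hw⟩ : ∃ w : SL(2, F), (w : Matrix (Fin 2) (Fin 2) F) = !![0, 1; -1, 0] :=
    ⟨⟨!![0, 1; -1, 0], by simp⟩, rfl⟩
  let φ : SL(2, F) →* SL(2, F) := (MulAut.conj w).toMonoidHom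
  have hφ : Function.Surjective φ := (MulAut.conj w).surjective
  have key : ∀ {p r s t : F}, SL2Mem H p r s t → SL2Mem (H.comap φ) t (-s) (-r) p := by
    rintro _ _ _ _ ⟨M, hM, rfl, rfl, rfl, rfl⟩
    obtain ⟨N, hN⟩ := hφ M
    refine ⟨N, by simpa [Subgroup.mem_comap, hN] using hM, ?_⟩
    have : N = w⁻¹ * M * w := by
      rw [← hN]
      simp [φ, mul_assoc]
    rw [this]
    simp [hw, Matrix.mul_apply, Fin.sum_univ_two, Matrix.SpecialLinearGroup.coe_inv,
      Matrix.adjugate_fin_two, Matrix.vecMul, dotProduct]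
  have : H.comap φ = ⊤ := by
    refine eq_top_of_upper (fun g hg ↦ ?_) (neg_ne_zero.2 hb) (key hB |>.congr rfl rfl neg_zero rfl)
      (key hx) (neg_ne_zero.2 hr)
    exact (key (hD g⁻¹ (inv_ne_zero hg))).congr (inv_inv g) neg_zero neg_zero rfl
  exact Subgroup.comap_injective hφ (this.trans (Subgroup.comap_top φ).symm)

/-- `H` contains the diagonal torus, and its upper and lower triangular elements are diagonal. -/
structure IsReductive (H : Subgroup SL(2, F)) : Prop where
  torus : ∀ g : F, g ≠ 0 → SL2Mem H g 0 0 g⁻¹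
  upper : ∀ b : F, SL2Mem H 1 b 0 1 → b = 0
  lower : ∀ b : F, SL2Mem H 1 0 b 1 → b = 0

namespace IsReductive

theorem upper_right (hH : IsReductive H) (h : SL2Mem H p r 0 t) : r = 0 := by
  have hdet := h.det
  have ht : t ≠ 0 := by rintro rfl; simp at hdet
  have := hH.upper (t * r) (((hH.torus t ht).mul h).congr (by linear_combination hdet) (by ring)
    (by ring) (by field_simp; ring))
  simpa [ht] using this

theorem lower_left (hH : IsReductive H) (h : SL2Mem H p 0 s t) : s = 0 := by
  have hdet := h.det
  have ht : p ≠ 0 := by rintro rfl; simp at hdet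
  have hp : t = p⁻¹ := by field_simp; linear_combination hdet
  have := hH.lower (p * s) (((hH.torus p ht).inv.mul h).congr (by field_simp; ring) (by ring)
    (by ring) (by linear_combination hdet))
  simpa [ht] using this

variable {g : F}

theorem lower_right (hH : IsReductive H) (hg : g ^ 2 ≠ 1) (hg0 : g ≠ 0)
    (h : SL2Mem H 0 r s t) : t = 0 := by
  have hdet := h.det
  have hs : s ≠ 0 := by rintro rfl; simp at hdet
  have h2 := ((h.mul (hH.torus g hg0)).mul h.inv).congr (r' := 0) rfl (by ring) rfl rfl
  have h3 := hH.lower_left h2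
  field_simp at h3
  have h4 : s * t * (g ^ 2 - 1) = 0 := by linear_combination h3
  simpa [hs, sub_eq_zero, hg] using h4

theorem upper_left (hH : IsReductive H) (hg : g ^ 2 ≠ 1) (hg0 : g ≠ 0)
    (h : SL2Mem H p r s 0) : p = 0 := by
  have hdet := h.det
  have hs : r ≠ 0 := by rintro rfl; simp at hdet
  have h2 := ((h.mul (hH.torus g hg0)).mul h.inv).congr (s' := 0) rfl rfl (by ring) rfl
  have h3 := hH.upper_right h2
  field_simp at h3
  have h4 : r * p * (g ^ 2 - 1) = 0 := by linear_combination -h3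
  simpa [hs, sub_eq_zero, hg] using h4

theorem cross_eq (hH : IsReductive H) (h : SL2Mem H p r s t) (h' : SL2Mem H p' r' s' t') {l : F}
    (hl : l ≠ 0) (e : p * s' = l ^ 2 * (p' * s)) : p * t * (r' * s') = p' * t' * (r * s) := by
  have h2 := ((h'.inv.mul (hH.torus l hl).inv).mul h).congr (s' := 0) rfl rfl
    (by field_simp; linear_combination -e) rfl
  have h3 := hH.upper_right h2
  field_simp at h3
  have : l ^ 2 * (p * t * (r' * s') - p' * t' * (r * s)) = 0 := by
    linear_combination (t' * r) * e - p * s' * h3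
  simpa [hl, sub_eq_zero] using this

theorem cross_mul (hH : IsReductive H) (hg : g ^ 2 ≠ 1) (hg0 : g ≠ 0) (h : SL2Mem H p r s t)
    (h' : SL2Mem H p' r' s' t') {l : F} (hl : l ≠ 0) (e : p * t' = l ^ 2 * (r' * s)) :
    p * t * (p' * t') = r * s * (r' * s') := by
  have h2 := ((h'.inv.mul (hH.torus l hl).inv).mul h).congr (p' := 0)
    (by field_simp; linear_combination e) rfl rfl rfl
  have h3 := hH.lower_right hg hg0 h2
  field_simp at h3
  have : l ^ 2 * (p * t * (p' * t') - r * s * (r' * s')) = 0 := by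
    linear_combination (s' * r) * e + p * t' * h3
  simpa [hl, sub_eq_zero] using this

/-- The cross ratio of the images of the two fixed points of the torus takes at most two mutually
inverse values on the non-monomial elements of `H`. -/
theorem cross_dichotomy [Finite F] (hH : IsReductive H) (hg : g ^ 2 ≠ 1) (hg0 : g ≠ 0)
    (h : SL2Mem H p r s t) (h' : SL2Mem H p' r' s' t') (hp : p ≠ 0) (hr : r ≠ 0) (hs : s ≠ 0)
    (ht : t ≠ 0) (hp' : p' ≠ 0) (hr' : r' ≠ 0) (hs' : s' ≠ 0) (ht' : t' ≠ 0) :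
    p' * t' * (r * s) = p * t * (r' * s') ∨ p * t * (p' * t') = r * s * (r' * s') := by
  have same : ∀ {p r s t p' r' s' t' : F}, SL2Mem H p r s t → SL2Mem H p' r' s' t' → s ≠ 0 →
      s' ≠ 0 → (∃ l : F, l ≠ 0 ∧ p * s = l ^ 2 * (p' * s')) →
      p * t * (r' * s') = p' * t' * (r * s) := by
    rintro p r s t p' r' s' t' h h' hs hs' ⟨l, hl, e⟩
    refine hH.cross_eq h h' (l := l * s' / s) (by positivity) ?_
    field_simp
    linear_combination e
  have mix : ∀ {p r s t p' r' s' t' : F}, SL2Mem H p r s t → SL2Mem H p' r' s' t' → s ≠ 0 →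
      t' ≠ 0 → (∃ l : F, l ≠ 0 ∧ p * s = l ^ 2 * (r' * t')) →
      p * t * (p' * t') = r * s * (r' * s') := by
    rintro p r s t p' r' s' t' h h' hs ht' ⟨l, hl, e⟩
    refine hH.cross_mul hg hg0 h h' (l := l * t' / s) (by positivity) ?_
    field_simp
    linear_combination e
  have self : ∀ {p r s t : F}, SL2Mem H p r s t → p ≠ 0 → s ≠ 0 → t ≠ 0 → r ≠ 0 →
      (∃ l : F, l ≠ 0 ∧ p * s = l ^ 2 * (r * t)) → p * t + r * s = 0 := by
    intro p r s t h hp hs ht hr e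
    have h1 := mix h h hs ht e
    linear_combination h1 - (p * t + r * s) * h.det
  have hps := mul_ne_zero hp hs
  have hrt := mul_ne_zero hr ht
  have hps' := mul_ne_zero hp' hs'
  have hrt' := mul_ne_zero hr' ht'
  rcases FiniteField.exists_eq_sq_mul hps hps' hrt' with e | e | e
  · exact Or.inl (same h h' hs hs' e).symm
  · exact Or.inr (mix h h' hs ht' e)
  · have h1 := self h' hp' hs' ht' hr' e
    rcases FiniteField.exists_eq_sq_mul hps' hps hrt with e | e | e
    · exact Or.inl (same h' h hs' hs e)
    · right
      linear_combination mix h' h hs' ht e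
    · have h2 := self h hp hs ht hr e
      left
      linear_combination r * s * h1 - r' * s' * h2

/-- A polynomial relation satisfied by every element `g` of the torus, read off from the cross
ratio of `x * diag(g, g⁻¹) * x`. -/
theorem torus_relation [Finite F] (hH : IsReductive H) (hg : g ^ 2 ≠ 1) (hg0 : g ≠ 0)
    (h : SL2Mem H p r s t) (hp : p ≠ 0) (hr : r ≠ 0) (hs : s ≠ 0) (ht : t ≠ 0) {w : F}
    (hw : w ≠ 0) :
    (w ^ 2 * p + t) * (w ^ 2 * p ^ 2 + r * s) *
      (p ^ 2 * w ^ 4 + (r * s + p * t) * w ^ 2 + t ^ 2) *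
      (p ^ 2 * (r * s) * w ^ 4 + p * t * (r * s + p * t) * w ^ 2 + r * s * t ^ 2) = 0 := by
  by_contra hne
  simp only [mul_eq_zero, not_or] at hne
  obtain ⟨⟨⟨h1, h2⟩, h3⟩, h4⟩ := hne
  have hdet := h.det
  have hy := (((h.mul (hH.torus w hw)).mul h)).congr (p' := (w ^ 2 * p ^ 2 + r * s) / w)
    (r' := r * (w ^ 2 * p + t) / w) (s' := s * (w ^ 2 * p + t) / w)
    (t' := (w ^ 2 * (r * s) + t ^ 2) / w) (by field_simp; ring) (by field_simp; ring)
    (by field_simp; ring) (by field_simp; ring)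
  have h5 : w ^ 2 * (r * s) + t ^ 2 ≠ 0 := by
    intro h5
    rw [h5, zero_div] at hy
    have := hH.upper_left hg hg0 hy
    exact h2 ((div_eq_zero_iff.1 this).resolve_right hw)
  rcases hH.cross_dichotomy hg hg0 h hy hp hr hs ht (by positivity) (by positivity) (by positivity)
    (by positivity) with e | e
  · field_simp at e
    apply h3
    linear_combination -e - (p ^ 2 * w ^ 4 + (r * s + p * t) * w ^ 2 + t ^ 2) * hdet
  · field_simp at e
    apply h4
    linear_combination e - (p ^ 2 * (r * s) * w ^ 4 + p * t * (r * s + p * t) * w ^ 2 +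
      r * s * t ^ 2) * hdet

end IsReductive
end SL2Mem

/-- In a field with 13 elements, the square class of `k` is not covered by the roots of these
polynomials. -/
theorem exists_mul_ne_zero_of_card_eq_thirteen {F : Type*} [Field F] [Fintype F]
    (hF : Fintype.card F = 13) (f k : F) (hf : f ≠ 0) (hf1 : f ≠ 1) (hk : k ≠ 0) :
    ∃ g : F, g ≠ 0 ∧ (g ^ 2 * k + 1) * (g ^ 2 * k + f) *
      ((g ^ 2 * k) ^ 2 + (f + 1) * (g ^ 2 * k) + 1) *
      (f * (g ^ 2 * k) ^ 2 + (f + 1) * (g ^ 2 * k) + f) ≠ 0 := by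
  let e := ZMod.ringEquivOfPrime F (by norm_num : Nat.Prime 13) hF
  have key : ∀ f k : ZMod 13, f ≠ 0 → f ≠ 1 → k ≠ 0 →
      ∃ g : ZMod 13, g ≠ 0 ∧ (g ^ 2 * k + 1) * (g ^ 2 * k + f) *
        ((g ^ 2 * k) ^ 2 + (f + 1) * (g ^ 2 * k) + 1) *
        (f * (g ^ 2 * k) ^ 2 + (f + 1) * (g ^ 2 * k) + f) ≠ 0 := by
    decide +kernel
  obtain ⟨f, rfl⟩ := e.surjective f
  obtain ⟨k, rfl⟩ := e.surjective k
  obtain ⟨g, hg, h⟩ := key f k (by simpa using hf) (by simpa using hf1) (by simpa using hk)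
  refine ⟨e g, by simpa using hg, ?_⟩
  rw [← map_ne_zero_iff e e.injective] at h
  simpa only [map_mul, map_add, map_pow, map_one] using h

namespace SL2Mem

variable {F : Type*} [Field F] {H : Subgroup SL(2, F)} {p r s t : F}

theorem IsReductive.not_of_card [Fintype F] (hH : IsReductive H) {g : F} (hg : g ^ 2 ≠ 1)
    (hg0 : g ≠ 0) (h : SL2Mem H p r s t) (hp : p ≠ 0) (hr : r ≠ 0) (hs : s ≠ 0) (ht : t ≠ 0) :
    Fintype.card F ≠ 13 ∧ Fintype.card F < 14 ∧ ¬Even (Fintype.card F) := by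
  have hdet := h.det
  have rel := fun {w : F} (hw : w ≠ 0) ↦ hH.torus_relation hg hg0 h hp hr hs ht hw
  refine ⟨fun h13 ↦ ?_, ?_, fun heven ↦ ?_⟩
  · have hf : r * s / (p * t) ≠ 1 := by
      intro e
      rw [div_eq_one_iff_eq (by positivity)] at e
      apply one_ne_zero (α := F)
      linear_combination -e - hdet
    obtain ⟨w, hw, hne⟩ := exists_mul_ne_zero_of_card_eq_thirteen h13 (r * s / (p * t)) (p / t)
      (by positivity) hf (by positivity)
    apply hne
    have := rel hw
    field_simp
    linear_combination this
  · open Polynomial in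
    by_contra! hcard
    let P : F[X] := X * (C p * X ^ 2 + C t) * (C (p ^ 2) * X ^ 2 + C (r * s)) *
      (C (p ^ 2) * X ^ 4 + C (r * s + p * t) * X ^ 2 + C (t ^ 2)) *
      (C (p ^ 2 * (r * s)) * X ^ 4 + C (p * t * (r * s + p * t)) * X ^ 2 + C (r * s * t ^ 2))
    have hP : P = 0 := by
      refine eq_zero_of_natDegree_lt_card_of_eval_eq_zero P Function.injective_id (fun w ↦ ?_)
        (lt_of_le_of_lt (b := 13) ?_ hcard)
      · rcases eq_or_ne w 0 with rfl | hw
        · simp [P]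
        · simp only [P, eval_mul, eval_add, eval_pow, eval_X, eval_C, id_eq]
          linear_combination w * rel hw
      · simp only [P]
        compute_degree
    have hne : ∀ q : F[X], q.eval 0 ≠ 0 → q ≠ 0 := by
      rintro q hq rfl
      simp at hq
    refine mul_ne_zero (mul_ne_zero (mul_ne_zero (mul_ne_zero X_ne_zero (hne _ ?_)) (hne _ ?_))
      (hne _ ?_)) (hne _ ?_) hP <;> simp [*]
  · have h2 : ringChar F = 2 := by
      rw [FiniteField.even_card_iff_char_two]
      exact Nat.even_iff.1 heven
    have : CharP F 2 := ringChar.of_eq h2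
    have htwo : (2 : F) = 0 := CharTwo.two_eq_zero
    obtain ⟨l, hl⟩ := FiniteField.isSquare_of_char_two h2 (p * t / (r * s))
    have hl0 : l ≠ 0 := by
      rintro rfl
      simp [hp, hr, hs, ht] at hl
    have := hH.cross_mul hg hg0 h h hl0 (by field_simp at hl ⊢; linear_combination hl)
    apply one_ne_zero (α := F)
    linear_combination this - (1 + p * t + r * s) * hdet - r * s * htwo

/-- A criterion for a subgroup of `SL(2, F)` containing the diagonal torus to be everything. -/
theorem eq_top [Fintype F] (hD : ∀ g : F, g ≠ 0 → SL2Mem H g 0 0 g⁻¹) {g : F}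
    (hg : g ^ 2 ≠ 1) (hg0 : g ≠ 0) (h : SL2Mem H p r s t) (hr : r ≠ 0) (hs : s ≠ 0)
    (hpt : p + t ≠ 0)
    (hc : p = 0 ∨ 13 ≤ Fintype.card F ∨ Even (Fintype.card F)) : H = ⊤ := by
  by_contra hne
  have hH : IsReductive H :=
    { torus := hD
      upper := fun b hb ↦ by_contra fun hb0 ↦ hne (eq_top_of_upper hD hb0 hb h hs)
      lower := fun b hb ↦ by_contra fun hb0 ↦ hne (eq_top_of_lower hD hb0 hb h hr) }
  have hp : p ≠ 0 := by
    rintro rfl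
    exact hpt (by rw [hH.lower_right hg hg0 h, add_zero])
  have ht : t ≠ 0 := by
    rintro rfl
    exact hp (hH.upper_left hg hg0 h)
  obtain ⟨h1, h2, h3⟩ := hH.not_of_card hg hg0 h hp hr hs ht
  rcases hc with hc | hc | hc
  · exact hp hc
  · omega
  · exact h3 hc

end SL2Mem

section Order

variable {F : Type*} [Field F] {K : Type*} [Field K] [Algebra F K]

/-- Powers of a matrix in `SL(2, F)` and of its eigenvalues are given by the same linear
expressions. -/
theorem Matrix.SpecialLinearGroup.exists_pow_eq (M : SL(2, F)) {ξ : K} (h0 : ξ ≠ 0)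
    (htr : algebraMap F K (M 0 0 + M 1 1) = ξ + ξ⁻¹) (n : ℕ) :
    ∃ u v : F, (M ^ n : SL(2, F)) = u • (M : Matrix (Fin 2) (Fin 2) F) + v • 1 ∧
      ξ ^ n = algebraMap F K u * ξ + algebraMap F K v ∧
      ξ⁻¹ ^ n = algebraMap F K u * ξ⁻¹ + algebraMap F K v := by
  induction n with
  | zero => exact ⟨0, 1, by simp, by simp, by simp⟩
  | succ n ih =>
    obtain ⟨u, v, hM, h1, h2⟩ := ih
    have hdet := M.det_coe
    rw [Matrix.det_fin_two] at hdet
    refine ⟨u * (M 0 0 + M 1 1) + v, -u, ?_, ?_, ?_⟩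
    · rw [pow_succ, Matrix.SpecialLinearGroup.coe_mul, hM]
      ext i j
      fin_cases i <;> fin_cases j <;> simp [Matrix.mul_apply, Fin.sum_univ_two]
      · linear_combination -u * hdet
      · ring
      · ring
      · linear_combination -u * hdet
    · rw [pow_succ, h1, map_add, map_mul, htr, map_neg]
      field_simp
      ring
    · rw [pow_succ, h2, map_add, map_mul, htr, map_neg]
      field_simp
      ring

/-- The order in `PSL(2, F)` of a non-scalar matrix with distinct eigenvalues `ξ, ξ⁻¹` is the
order of `ξ ^ 2`. -/
theorem Matrix.ProjectiveSpecialLinearGroup.orderOf_mk (M : SL(2, F)) {ξ : K} (h0 : ξ ≠ 0)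
    (h1 : ξ ^ 2 ≠ 1) (htr : algebraMap F K (M 0 0 + M 1 1) = ξ + ξ⁻¹)
    (hM : M 0 1 ≠ 0 ∨ M 0 0 ≠ M 1 1) :
    orderOf (QuotientGroup.mk M : PSL(2, F)) = orderOf (ξ ^ 2) := by
  rw [orderOf_eq_orderOf_iff]
  intro n
  rw [← QuotientGroup.mk_pow, QuotientGroup.eq_one_iff, Matrix.SpecialLinearGroup.mem_center_iff]
  obtain ⟨u, v, e, e1, e2⟩ := M.exists_pow_eq h0 htr n
  rw [← pow_mul, mul_comm, pow_mul]
  constructor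
  · rintro ⟨c, -, hc⟩
    rw [e] at hc
    have hu : u = 0 := by
      have e01 := congr_fun (congr_fun hc 0) 1
      have e00 := congr_fun (congr_fun hc 0) 0
      have e11 := congr_fun (congr_fun hc 1) 1
      simp at e01 e00 e11
      rcases hM with hM | hM
      · exact e01.resolve_right hM
      · have : u * (M 0 0 - M 1 1) = 0 := by linear_combination e11 - e00
        exact (mul_eq_zero.1 this).resolve_right (sub_ne_zero.2 hM)
    subst hu
    have : ξ ^ n = ξ⁻¹ ^ n := by rw [e1, e2]; simp
    rw [sq]
    nth_rw 1 [this]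
    rw [← mul_pow, inv_mul_cancel₀ h0, one_pow]
  · intro h
    have h3 : ξ ^ n = ξ⁻¹ ^ n := by
      rw [inv_pow]
      exact eq_inv_of_mul_eq_one_left (by rw [← sq, h])
    have hu : u = 0 := by
      have h4 : algebraMap F K u * (ξ ^ 2 - 1) = 0 := by
        rw [e1, e2] at h3
        field_simp at h3
        linear_combination h3
      simpa [sub_eq_zero, h1] using h4
    subst hu
    refine ⟨v, ?_, ?_⟩
    · rw [Fintype.card_fin]
      apply (algebraMap F K).injective
      rw [map_pow, map_one, ← h, e1]
      simp
    · rw [e]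
      simp [Matrix.smul_one_eq_diagonal]

end Order

/-- An element of an extension of a finite field with `q` elements that is fixed by the `q`-power
map lies in the base field. -/
theorem FiniteField.exists_algebraMap_eq_of_pow_card {F K : Type*} [Field F] [Fintype F] [Field K]
    [Algebra F K] {x : K} (hx : x ^ Fintype.card F = x) : ∃ c : F, algebraMap F K c = x := by
  open Polynomial in
  have hs : (X ^ Fintype.card F - X : F[X]).Splits := by
    rw [splits_iff_card_roots, FiniteField.roots_X_pow_card_sub_X, ← Finset.card_def,
      Finset.card_univ, FiniteField.X_pow_card_sub_X_natDegree_eq F Fintype.one_lt_card]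
  open Polynomial in
  exact hs.mem_range_of_isRoot (FiniteField.X_pow_card_sub_X_ne_zero F Fintype.one_lt_card)
    (i := algebraMap F K) (by simp [hx])

/-- There is an element of order `q + 1` in an extension of the field with `q` elements whose
trace lies in the base field. -/
theorem FiniteField.exists_orderOf_eq_card_add_one (F : Type*) [Field F] [Fintype F] :
    ∃ (ξ : AlgebraicClosure F) (τ : F), orderOf ξ = Fintype.card F + 1 ∧
      algebraMap F (AlgebraicClosure F) τ = ξ + ξ⁻¹ := by
  have : NeZero ((Fintype.card F + 1 : ℕ) : F) := ⟨by simp⟩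
  obtain ⟨ξ, hξ⟩ := HasEnoughRootsOfUnity.exists_primitiveRoot (AlgebraicClosure F)
    (Fintype.card F + 1)
  have h0 : ξ ≠ 0 := hξ.ne_zero (by omega)
  have hq : ξ ^ Fintype.card F = ξ⁻¹ :=
    eq_inv_of_mul_eq_one_left (by rw [← pow_succ, hξ.pow_eq_one])
  obtain ⟨τ, hτ⟩ := FiniteField.exists_algebraMap_eq_of_pow_card (F := F)
    (x := ξ + ξ⁻¹) (by
      obtain ⟨p, hp⟩ := CharP.exists F
      have hpp : p.Prime := (CharP.char_is_prime_or_zero F p).resolve_right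
        (CharP.char_ne_zero_of_finite F p)
      have : Fact p.Prime := ⟨hpp⟩
      have : CharP (AlgebraicClosure F) p := charP_of_injective_algebraMap
        (algebraMap F (AlgebraicClosure F)).injective p
      obtain ⟨n, -, hn⟩ := FiniteField.card F p
      rw [hn, add_pow_char_pow, ← hn, hq, inv_pow, hq, inv_inv, add_comm])
  exact ⟨ξ, τ, hξ.eq_orderOf.symm, hτ⟩

theorem ne_zero_of_orderOf_pos {M₀ : Type*} [MonoidWithZero M₀] [Nontrivial M₀] {x : M₀}
    (h : 0 < orderOf x) : x ≠ 0 := by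
  rintro rfl
  simp [orderOf_zero] at h

/-- An element of order `q - 1` in the field with `q` elements generates its nonzero elements. -/
theorem FiniteField.exists_pow_eq_of_orderOf_eq {F : Type*} [Field F] [Fintype F] {a : F}
    (ha : orderOf a = Fintype.card F - 1) {g : F} (hg : g ≠ 0) : ∃ n : ℕ, a ^ n = g := by
  have hcard := Fintype.one_lt_card (α := F)
  have ha0 : a ≠ 0 := ne_zero_of_orderOf_pos (by omega)
  have htop : Subgroup.zpowers (Units.mk0 a ha0) = ⊤ := by
    apply Subgroup.eq_top_of_card_eq
    rw [Nat.card_zpowers, ← orderOf_units, Units.val_mk0, ha, Nat.card_units,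
      Nat.card_eq_fintype_card]
  have hmem : Units.mk0 g hg ∈ Subgroup.zpowers (Units.mk0 a ha0) := htop ▸ Subgroup.mem_top _
  obtain ⟨n, hn⟩ := mem_powers_iff_mem_zpowers.2 hmem
  exact ⟨n, by simpa using congr_arg Units.val hn⟩

section Triple

variable {F : Type*} [Field F]

/-- The matrix of determinant one with diagonal `(p, t)` and upper right entry `1`. -/
def Matrix.SpecialLinearGroup.ofDiagonal (p t : F) : SL(2, F) :=
  ⟨!![p, 1; p * t - 1, t], by rw [Matrix.det_fin_two_of]; ring⟩

/-- The diagonal matrix with entries `a` and `a⁻¹`. -/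
def Matrix.SpecialLinearGroup.torus (a : F) (ha : a ≠ 0) : SL(2, F) :=
  ⟨!![a, 0; 0, a⁻¹], by rw [Matrix.det_fin_two_of]; field_simp; ring⟩

open Matrix.SpecialLinearGroup Matrix.ProjectiveSpecialLinearGroup

theorem SL2Mem.torus_pow {H : Subgroup SL(2, F)} {a : F} (h : SL2Mem H a 0 0 a⁻¹) (n : ℕ) :
    SL2Mem H (a ^ n) 0 0 (a ^ n)⁻¹ := by
  induction n with
  | zero => exact ⟨1, one_mem H, by simp⟩
  | succ n ih => exact (ih.mul h).congr (by ring) (by ring) (by ring) (by field_simp; ring)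

/-- Sufficient conditions on the diagonal entries of two matrices for their images in `PSL(2, F)`
to be part of a generating triple of type `((q + 1) / d, (q - 1) / d, (q - 1) / d)`. -/
theorem Matrix.ProjectiveSpecialLinearGroup.exists_generating_triple [Fintype F]
    (hq : 7 ≤ Fintype.card F) {K : Type*} [Field K] [Algebra F K] {ξ : K}
    (hξ : orderOf ξ = Fintype.card F + 1) {p t a b : F}
    (hpt : algebraMap F K (p + t) = ξ + ξ⁻¹) (hab : p * a + t * a⁻¹ = b + b⁻¹)
    (ha : orderOf a = Fintype.card F - 1)
    (hb : orderOf (b ^ 2) = (Fintype.card F - 1) / Nat.gcd 2 (Fintype.card F - 1))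
    (hc : p = 0 ∨ 13 ≤ Fintype.card F ∨ Even (Fintype.card F)) :
    ∃ x y z : PSL(2, F), x * y * z = 1 ∧
      Subgroup.closure ({x, y, z} : Set PSL(2, F)) = ⊤ ∧
      orderOf x = (Fintype.card F + 1) / Nat.gcd 2 (Fintype.card F - 1) ∧
      orderOf y = (Fintype.card F - 1) / Nat.gcd 2 (Fintype.card F - 1) ∧
      orderOf z = (Fintype.card F - 1) / Nat.gcd 2 (Fintype.card F - 1) := by
  have hd : Nat.gcd (Fintype.card F + 1) 2 = Nat.gcd 2 (Fintype.card F - 1) := by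
    rw [Nat.gcd_comm, show Fintype.card F + 1 = Fintype.card F - 1 + 2 by omega,
      Nat.gcd_add_self_right]
  have hquot : 2 ≤ (Fintype.card F - 1) / Nat.gcd 2 (Fintype.card F - 1) := by
    rw [Nat.le_div_iff_mul_le (Nat.gcd_pos_of_pos_left _ (by norm_num))]
    have := Nat.gcd_le_left (Fintype.card F - 1) (show 0 < 2 by norm_num)
    omega
  have hξ0 : ξ ≠ 0 := ne_zero_of_orderOf_pos (by omega)
  have ha0 : a ≠ 0 := ne_zero_of_orderOf_pos (by omega)
  have hb0 : b ≠ 0 := fun h ↦ ne_zero_of_orderOf_pos (x := b ^ 2) (by omega) (by simp [h])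
  have ha2 : a ^ 2 ≠ 1 := by
    intro h
    have := Nat.le_of_dvd (by norm_num) (orderOf_dvd_of_pow_eq_one h)
    omega
  have hb2 : b ^ 2 ≠ 1 := by
    intro h
    rw [h, orderOf_one] at hb
    omega
  have hξ2 : ξ ^ 2 ≠ 1 := by
    intro h
    have := Nat.le_of_dvd (by norm_num) (orderOf_dvd_of_pow_eq_one h)
    omega
  have hξ4 : p + t ≠ 0 := by
    intro h
    rw [h, map_zero] at hpt
    have h4 : ξ ^ 4 = 1 := by
      field_simp at hpt
      linear_combination (1 - ξ ^ 2) * hpt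
    have := Nat.le_of_dvd (by norm_num) (orderOf_dvd_of_pow_eq_one h4)
    omega
  have hmem : ∀ c : F, ξ ≠ algebraMap F K c := by
    rintro c rfl
    have h1 : c ≠ 0 := by
      rintro rfl
      simp at hξ0
    have := Nat.le_of_dvd (by omega) (orderOf_dvd_of_pow_eq_one (x := algebraMap F K c)
      (n := Fintype.card F - 1) (by rw [← map_pow, FiniteField.pow_card_sub_one_eq_one c h1,
        map_one]))
    omega
  have hs : p * t - 1 ≠ 0 := by
    intro h
    have h1 : (ξ - algebraMap F K p) * (ξ - algebraMap F K t) = 0 := by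
      have h2 := congr_arg (algebraMap F K) h
      simp only [map_sub, map_mul, map_one, map_zero, map_add] at h2 hpt
      have h3 : ξ * ξ⁻¹ = 1 := mul_inv_cancel₀ hξ0
      linear_combination h2 - ξ * hpt - h3
    rcases mul_eq_zero.1 h1 with h1 | h1
    · exact hmem p (sub_eq_zero.1 h1)
    · exact hmem t (sub_eq_zero.1 h1)
  let X := ofDiagonal p t
  let Y := torus a ha0
  let x : PSL(2, F) := QuotientGroup.mk X
  let y : PSL(2, F) := QuotientGroup.mk Y
  have hordb : orderOf (a ^ 2) = (Fintype.card F - 1) / Nat.gcd 2 (Fintype.card F - 1) := by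
    rw [orderOf_pow' a two_ne_zero, ha, Nat.gcd_comm]
  have hx : orderOf x = orderOf (ξ ^ 2) :=
    orderOf_mk X hξ0 hξ2 hpt (Or.inl (by simp [X, ofDiagonal]))
  have hy : orderOf y = orderOf (a ^ 2) :=
    orderOf_mk (K := F) Y ha0 ha2 rfl (Or.inr (by
      simp only [Y, torus]
      intro h
      apply ha2
      simp at h
      field_simp at h
      exact h))
  have hxy : orderOf (x * y) = orderOf (b ^ 2) := by
    refine orderOf_mk (K := F) (X * Y) hb0 hb2 ?_ (Or.inl ?_)
    · rw [← hab]
      rw [Matrix.SpecialLinearGroup.coe_mul]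
      simp [X, Y, ofDiagonal, torus, Matrix.mul_apply, Fin.sum_univ_two]
    · rw [Matrix.SpecialLinearGroup.coe_mul]
      simp [X, Y, ofDiagonal, torus, Matrix.mul_apply, Fin.sum_univ_two, ha0]
  refine ⟨x, y, (x * y)⁻¹, mul_inv_cancel _, ?_, ?_, hy.trans hordb, ?_⟩
  · set S := Subgroup.closure ({x, y, (x * y)⁻¹} : Set PSL(2, F)) with hS
    let H := S.comap (QuotientGroup.mk' _)
    have hXH : X ∈ H := Subgroup.mem_comap.2 (Subgroup.subset_closure (by simp [x]))
    have hYH : Y ∈ H := Subgroup.mem_comap.2 (Subgroup.subset_closure (by simp [y]))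
    have hYmem : SL2Mem H a 0 0 a⁻¹ := SL2Mem.of_mem hYH
    have hXmem : SL2Mem H p 1 (p * t - 1) t := SL2Mem.of_mem hXH
    have htop : H = ⊤ := by
      refine SL2Mem.eq_top (fun g hg ↦ ?_) ha2 ha0 hXmem one_ne_zero hs hξ4 hc
      obtain ⟨n, rfl⟩ := FiniteField.exists_pow_eq_of_orderOf_eq ha hg
      exact hYmem.torus_pow n
    exact Subgroup.comap_injective (QuotientGroup.mk'_surjective _)
      (htop.trans (Subgroup.comap_top _).symm)
  · rw [hx, orderOf_pow' ξ two_ne_zero, hξ, hd]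
  · rw [orderOf_inv, hxy, hb]

end Triple

/-- The order of an element of a field of prime cardinality can be computed in `ZMod`. -/
theorem FiniteField.orderOf_natCast_of_card_eq {F : Type*} [Field F] [Fintype F] {ℓ : ℕ}
    (hℓ : ℓ.Prime) (hcard : Fintype.card F = ℓ) (m : ℕ) :
    orderOf (m : F) = orderOf (m : ZMod ℓ) := by
  rw [← MulEquiv.orderOf_eq (ZMod.ringEquivOfPrime F hℓ hcard).toMulEquiv]
  simp

theorem FiniteField.exists_orderOf_eq_card_sub_one (F : Type*) [Field F] [Fintype F] :
    ∃ a : F, orderOf a = Fintype.card F - 1 := by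
  classical
  obtain ⟨u, hu⟩ := IsCyclic.exists_generator (α := Fˣ)
  refine ⟨u, ?_⟩
  rw [orderOf_units, orderOf_eq_card_of_forall_mem_zpowers hu, Nat.card_units,
    Nat.card_eq_fintype_card]

theorem pow_eq_neg_one_of_orderOf_eq {K : Type*} [Field K] {ξ : K} {n : ℕ} (hn : 0 < n)
    (h : orderOf ξ = 2 * n) : ξ ^ n = -1 := by
  have h1 : (ξ ^ n) ^ 2 = 1 := by rw [← pow_mul, mul_comm, ← h, pow_orderOf_eq_one]
  refine (sq_eq_one_iff.1 h1).resolve_left fun h2 ↦ ?_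
  have := Nat.le_of_dvd hn (orderOf_dvd_of_pow_eq_one h2)
  omega

/-- For `q = p₀^e` with `q ∈ {7, 8}` or `q ≥ 11`, and `d = gcd(2, q−1)`, the group
`PSL₂(F_q)` has a generating triple of type `((q+1)/d, (q−1)/d, (q−1)/d)`. -/
theorem psl2_gen_triple_q1_q2_q2 (F : Type*) [Field F] [Fintype F] (p₀ e : ℕ)
    (hp : p₀.Prime) (hcard : Fintype.card F = p₀ ^ e)
    (hq : Fintype.card F = 7 ∨ Fintype.card F = 8 ∨ 11 ≤ Fintype.card F) :
    ∃ x y z : PSL(2, F), x * y * z = 1 ∧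
      Subgroup.closure ({x, y, z} : Set PSL(2, F)) = ⊤ ∧
      orderOf x = (Fintype.card F + 1) / Nat.gcd 2 (Fintype.card F - 1) ∧
      orderOf y = (Fintype.card F - 1) / Nat.gcd 2 (Fintype.card F - 1) ∧
      orderOf z = (Fintype.card F - 1) / Nat.gcd 2 (Fintype.card F - 1) := by
  obtain ⟨ξ, τ, hξ, hτ⟩ := FiniteField.exists_orderOf_eq_card_add_one F
  have hξ0 : ξ ≠ 0 := ne_zero_of_orderOf_pos (by omega)
  have hcases : Fintype.card F = 7 ∨ Fintype.card F = 11 ∨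
      (7 ≤ Fintype.card F ∧ (13 ≤ Fintype.card F ∨ Even (Fintype.card F))) := by
    rw [Nat.even_iff]
    omega
  rcases hcases with h7 | h11 | ⟨h, h'⟩
  · have hτ2 : τ ^ 2 = 2 := by
      apply (algebraMap F (AlgebraicClosure F)).injective
      have := pow_eq_neg_one_of_orderOf_eq (n := 4) (by norm_num) (by rw [hξ, h7])
      rw [map_pow, hτ, map_ofNat]
      field_simp
      linear_combination this
    have hF : (7 : F) = 0 := by
      have := FiniteField.cast_card_eq_zero F
      rw [h7] at this
      exact_mod_cast this
    have h3 : orderOf (3 : F) = 6 := by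
      have := FiniteField.orderOf_natCast_of_card_eq (by norm_num) h7 3
      push_cast at this
      rw [this, orderOf_eq_iff (by norm_num)]
      decide
    have h2 : orderOf (2 : F) = 3 := by
      have := FiniteField.orderOf_natCast_of_card_eq (by norm_num) h7 2
      push_cast at this
      rw [this, orderOf_eq_iff (by norm_num)]
      decide
    have h30 : (3 : F) * 5 = 1 := by linear_combination 2 * hF
    have hτi : τ⁻¹ = 4 * τ := inv_eq_of_mul_eq_one_right (by
      linear_combination 4 * hτ2 + hF)
    refine Matrix.ProjectiveSpecialLinearGroup.exists_generating_triple (by omega) hξ (p := 0)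
      (t := τ) (a := 3) (b := τ) (by rw [zero_add, hτ]) ?_ (by rw [h3, h7]) ?_ (Or.inl rfl)
    · rw [inv_eq_of_mul_eq_one_right h30, hτi]
      ring
    · rw [hτ2, h2, h7]
      norm_num
  · have hτ2 : τ ^ 2 = 3 := by
      apply (algebraMap F (AlgebraicClosure F)).injective
      have h6 := pow_eq_neg_one_of_orderOf_eq (n := 6) (by norm_num) (by rw [hξ, h11])
      have h2 : ξ ^ 2 + 1 ≠ 0 := by
        intro h2
        have h4 : ξ ^ 4 = 1 := by linear_combination (ξ ^ 2 - 1) * h2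
        have := Nat.le_of_dvd (by norm_num) (orderOf_dvd_of_pow_eq_one h4)
        omega
      rw [map_pow, hτ, map_ofNat]
      field_simp
      apply mul_left_cancel₀ h2
      linear_combination h6
    have hF : (11 : F) = 0 := by
      have := FiniteField.cast_card_eq_zero F
      rw [h11] at this
      exact_mod_cast this
    have h2 : orderOf (2 : F) = 10 := by
      have := FiniteField.orderOf_natCast_of_card_eq (by norm_num) h11 2
      push_cast at this
      rw [this, orderOf_eq_iff (by norm_num)]
      decide
    have h4 : orderOf (4 : F) = 5 := by
      have := FiniteField.orderOf_natCast_of_card_eq (by norm_num) h11 4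
      push_cast at this
      rw [this, orderOf_eq_iff (by norm_num)]
      decide
    have h20 : (2 : F) * 6 = 1 := by linear_combination hF
    have hτi : (7 * τ)⁻¹ = 10 * τ := inv_eq_of_mul_eq_one_right (by
      linear_combination 70 * hτ2 + 19 * hF)
    refine Matrix.ProjectiveSpecialLinearGroup.exists_generating_triple (by omega) hξ (p := 0)
      (t := τ) (a := 2) (b := 7 * τ) (by rw [zero_add, hτ]) ?_ (by rw [h2, h11]) ?_ (Or.inl rfl)
    · rw [inv_eq_of_mul_eq_one_right h20, hτi]
      linear_combination -τ * hF
    · rw [show (7 * τ) ^ 2 = 4 by linear_combination 49 * hτ2 + 13 * hF, h4, h11]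
      norm_num
  · obtain ⟨a, ha⟩ := FiniteField.exists_orderOf_eq_card_sub_one F
    have ha0 : a ≠ 0 := ne_zero_of_orderOf_pos (by omega)
    have ha2 : a ^ 2 - 1 ≠ 0 := by
      intro h2
      have := Nat.le_of_dvd (by norm_num) (orderOf_dvd_of_pow_eq_one (sub_eq_zero.1 h2))
      omega
    refine Matrix.ProjectiveSpecialLinearGroup.exists_generating_triple h hξ
      (p := (a ^ 2 + 1 - τ) / (a ^ 2 - 1)) (t := τ - (a ^ 2 + 1 - τ) / (a ^ 2 - 1)) (a := a)
      (b := a) (by rw [← hτ]; ring_nf) ?_ ha ?_ (Or.inr h')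
    · field_simp
      ring
    · rw [orderOf_pow' a two_ne_zero, ha, Nat.gcd_comm]
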